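/- arXiv:2008.08654 — 2 statements merged into one kernel-verified Lean document; each statement's English description precedes it below -/
import Mathlib

section
/- Let r = 2^ℓ > 1 and u > r be powers of two and let p = 2^b − 1 > u be a (Mersenne) prime. Let h : [u] → [p] be a 4-universal random hash function, and define for each key x: i(x) = h(x) mod 2^ℓ and a(x) = ⌊h(x)/2^{b−1}⌋ and s(x) = 1 − 2·a(x) ∈ {−1,1}. For any values f : [u] → ℤ, the Count Sketch estimator X = Σ_{j∈[r]} ( Σ_{x∈[u]} s(x)·f(x)·[i(x)=j] )² satisfies: (1) E[X] = F₂ + (F₁² − F₂)/p², (2) |E[X] − F₂| ≤ F₂·(n − 1)/p², and (3) Var[X] < 2·F₂²/r, where F₁ = Σ_x f(x), F₂ = Σ_x f(x)², and n = |{x : f(x) ≠ 0}| (assuming n ≥ 1). -/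
open MeasureTheory ProbabilityTheory

/-- The sign `1 - 2⌊v / M⌋` attached to a hash value `v`. -/
noncomputable def hashSign (M v : ℕ) : ℝ := 1 - 2 * ((v / M : ℕ) : ℝ)

/-- The product of the signs of two hash values falling in the same bucket modulo `r`,
and `0` for values in different buckets. -/
noncomputable def signedCollision (M r v w : ℕ) : ℝ :=
  hashSign M v * hashSign M w * if v % r = w % r then 1 else 0

lemma hashSign_of_lt {M v : ℕ} (hv : v < M) : hashSign M v = 1 := by
  simp [hashSign, Nat.div_eq_of_lt hv]

lemma hashSign_add {M v : ℕ} (hv : v < M) : hashSign M (M + v) = -1 := by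
  have : (M + v) / M = 1 := by
    rw [Nat.add_div_left _ (by omega), Nat.div_eq_of_lt hv]
  rw [hashSign, this]; norm_num

lemma hashSign_sq {M v : ℕ} (hv : v < 2 * M) : hashSign M v ^ 2 = 1 := by
  rcases lt_or_ge v M with h | h
  · rw [hashSign_of_lt h]; norm_num
  · obtain ⟨w, rfl⟩ := Nat.exists_eq_add_of_le h
    rw [hashSign_add (by omega)]; norm_num

lemma signedCollision_comm (M r v w : ℕ) :
    signedCollision M r v w = signedCollision M r w v := by
  unfold signedCollision
  rw [mul_comm (hashSign M v), if_congr eq_comm rfl rfl]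

lemma sum_range_mod_eq {r c : ℕ} (k : ℕ) (hc : c < r) :
    ∑ v ∈ Finset.range (r * k), (if v % r = c then (1 : ℝ) else 0) = k := by
  induction k with
  | zero => simp
  | succ k ih =>
    rw [Nat.mul_succ, Finset.sum_range_add, ih]
    have : ∀ v ∈ Finset.range r, (if (r * k + v) % r = c then (1 : ℝ) else 0)
        = if v = c then 1 else 0 := by
      intro v hv
      rw [Nat.mul_add_mod, Nat.mod_eq_of_lt (Finset.mem_range.1 hv)]
    rw [Finset.sum_congr rfl this]
    simp [hc]

section Mersenne

variable {M r k p c : ℕ}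

lemma pred_mod_eq (hM : M = r * k) (hM0 : 0 < M) (hp : p + 1 = 2 * M) : p % r = r - 1 := by
  subst hM
  have hr : 0 < r := Nat.pos_of_mul_pos_right hM0
  have hk : 0 < k := Nat.pos_of_mul_pos_left hM0
  obtain ⟨k, rfl⟩ := Nat.exists_eq_add_of_lt hk
  have : p = (r - 1) + r * (2 * k + 1) := by
    obtain ⟨r, rfl⟩ := Nat.exists_eq_add_of_lt hr
    simp only [zero_add, Nat.add_sub_cancel] at *
    nlinarith
  rw [this, Nat.add_mul_mod_self_left, Nat.mod_eq_of_lt (by omega)]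

lemma sum_range_pred_mod_eq (hM : M = r * k) (hM0 : 0 < M) (hp : p + 1 = 2 * M) (hc : c < r) :
    ∑ v ∈ Finset.range p, (if v % r = c then (1 : ℝ) else 0)
      = 2 * k - if c = r - 1 then 1 else 0 := by
  have h1 := sum_range_mod_eq (2 * k) hc
  rw [show r * (2 * k) = p + 1 by rw [hp, hM]; ring, Finset.sum_range_succ,
    pred_mod_eq hM hM0 hp, if_congr (eq_comm (a := r - 1)) rfl rfl] at h1
  push_cast at h1
  linarith

lemma sum_hashSign_mod_eq (hM : M = r * k) (hM0 : 0 < M) (hp : p + 1 = 2 * M) :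
    ∑ v ∈ Finset.range p, hashSign M v * (if v % r = c then (1 : ℝ) else 0)
      = if c = r - 1 then 1 else 0 := by
  have h1 : ∑ v ∈ Finset.range (M + M), hashSign M v * (if v % r = c then (1 : ℝ) else 0)
      = 0 := by
    rw [Finset.sum_range_add, ← Finset.sum_add_distrib]
    refine Finset.sum_eq_zero fun v hv => ?_
    have hv := Finset.mem_range.1 hv
    have : (M + v) % r = v % r := by rw [hM, Nat.mul_add_mod]
    rw [hashSign_of_lt hv, hashSign_add hv, this]
    ring
  have h2 : hashSign M p = -1 := by
    rw [show p = M + (M - 1) by omega, hashSign_add (by omega)]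
  rw [show M + M = p + 1 by omega, Finset.sum_range_succ, h2, pred_mod_eq hM hM0 hp,
    if_congr (eq_comm (a := r - 1)) rfl rfl] at h1
  linarith

lemma sum_signedCollision (hM : M = r * k) (hM0 : 0 < M) (hp : p + 1 = 2 * M) (v : ℕ) :
    ∑ w ∈ Finset.range p, signedCollision M r v w
      = hashSign M v * if v % r = r - 1 then 1 else 0 := by
  rw [← sum_hashSign_mod_eq hM hM0 hp, Finset.mul_sum]
  refine Finset.sum_congr rfl fun w _ => ?_
  rw [signedCollision, mul_assoc, if_congr eq_comm rfl rfl]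

lemma sum_signedCollision_sq (hM : M = r * k) (hM0 : 0 < M) (hp : p + 1 = 2 * M) :
    ∑ v ∈ Finset.range p, ∑ w ∈ Finset.range p, signedCollision M r v w ^ 2
      = 2 * k * p - (2 * k - 1) := by
  have hr : 0 < r := Nat.pos_of_mul_pos_right (hM ▸ hM0)
  have h1 : ∀ v ∈ Finset.range p, ∑ w ∈ Finset.range p, signedCollision M r v w ^ 2
      = 2 * k - if v % r = r - 1 then 1 else 0 := by
    intro v hv
    rw [← sum_range_pred_mod_eq hM hM0 hp (Nat.mod_lt v hr)]
    refine Finset.sum_congr rfl fun w hw => ?_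
    rw [signedCollision, mul_pow, mul_pow,
      hashSign_sq (by have := Finset.mem_range.1 hv; omega),
      hashSign_sq (by have := Finset.mem_range.1 hw; omega), if_congr eq_comm rfl rfl]
    simp
  rw [Finset.sum_congr rfl h1, Finset.sum_sub_distrib,
    sum_range_pred_mod_eq hM hM0 hp (by omega)]
  simp
  ring

end Mersenne

section Universal

variable {Ω : Type*} [MeasureSpace Ω] {α : Type*} [Fintype α] [MeasurableSpace α]
  [MeasurableSingletonClass α]

lemma integrable_comp_of_fintype [IsFiniteMeasure (ℙ : Measure Ω)] {V : Ω → α}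
    (hV : Measurable V) (G : α → ℝ) : Integrable fun ω => G (V ω) :=
  (Integrable.of_finite (μ := Measure.map V ℙ) (f := G)).comp_measurable hV

lemma integral_comp_of_uniform [IsFiniteMeasure (ℙ : Measure Ω)] {V : Ω → α}
    (hV : Measurable V) {c : ENNReal}
    (hc : ∀ y, ℙ {ω | V ω = y} = c) (G : α → ℝ) :
    ∫ ω, G (V ω) = c.toReal * ∑ y, G y := by
  rw [← integral_map (f := G) hV.aemeasurable
      (measurable_of_finite G).aestronglyMeasurable, integral_fintype Integrable.of_finite,
    Finset.mul_sum]
  refine Finset.sum_congr rfl fun y _ => ?_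
  rw [Measure.real, Measure.map_apply hV (measurableSet_singleton y), smul_eq_mul]
  congr 2
  exact hc y

lemma sum_fin_succ_arrow {β : Type*} [Fintype β] {n : ℕ} (G : (Fin (n + 1) → β) → ℝ) :
    ∑ v, G v = ∑ a, ∑ v : Fin n → β, G (Fin.cons a v) := by
  rw [← (Fin.consEquiv fun _ => β).sum_comp, Fintype.sum_prod_type]
  rfl

end Universal

/-- `k`-universality of a random hash function: the values at any `j ≤ k` distinct keys are
independent and uniform. -/
def IsUniversalHash {Ω : Type*} [MeasureSpace Ω] {u p : ℕ} (k : ℕ)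
    (h : Ω → Fin u → Fin p) : Prop :=
  ∀ j : ℕ, j ≤ k → ∀ x : Fin j → Fin u, Function.Injective x →
    ∀ y : Fin j → Fin p, ℙ {ω | ∀ m : Fin j, h ω (x m) = y m} = (p : ENNReal)⁻¹ ^ j

section UniversalHash

variable {Ω : Type*} [MeasureSpace Ω] [IsFiniteMeasure (ℙ : Measure Ω)] {u p : ℕ}
  {h : Ω → Fin u → Fin p}

namespace IsUniversalHash

lemma integral_eq (huniv : IsUniversalHash 4 h) (hmeas : ∀ x, Measurable fun ω => h ω x)
    {j : ℕ} (hj : j ≤ 4) {x : Fin j → Fin u} (hx : Function.Injective x)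
    (G : (Fin j → Fin p) → ℝ) :
    ∫ ω, G (fun m => h ω (x m)) = ((p : ℝ) ^ j)⁻¹ * ∑ y, G y := by
  rw [integral_comp_of_uniform (V := fun ω m => h ω (x m))
    (measurable_pi_lambda _ fun m => hmeas (x m)) (c := (p : ENNReal)⁻¹ ^ j) _ G]
  · simp
  · intro y
    rw [← huniv j hj x hx y]
    simp only [funext_iff]

lemma integral_two (huniv : IsUniversalHash 4 h) (hmeas : ∀ x, Measurable fun ω => h ω x)
    {x y : Fin u} (hxy : x ≠ y) (G : Fin p → Fin p → ℝ) :
    ∫ ω, G (h ω x) (h ω y) = ((p : ℝ) ^ 2)⁻¹ * ∑ a, ∑ b, G a b := by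
  have := huniv.integral_eq hmeas (j := 2) (by norm_num) (x := ![x, y])
    (by intro a b; fin_cases a <;> fin_cases b <;> simp [hxy, hxy.symm])
    (fun v => G (v 0) (v 1))
  simpa [sum_fin_succ_arrow, Fintype.sum_unique] using this

lemma integral_three (huniv : IsUniversalHash 4 h) (hmeas : ∀ x, Measurable fun ω => h ω x)
    {x y z : Fin u} (hxy : x ≠ y) (hxz : x ≠ z) (hyz : y ≠ z) (G : Fin p → Fin p → Fin p → ℝ) :
    ∫ ω, G (h ω x) (h ω y) (h ω z) = ((p : ℝ) ^ 3)⁻¹ * ∑ a, ∑ b, ∑ c, G a b c := by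
  have := huniv.integral_eq hmeas (j := 3) (by norm_num) (x := ![x, y, z])
    (by intro a b; fin_cases a <;> fin_cases b <;>
          simp [hxy, hxy.symm, hxz, hxz.symm, hyz, hyz.symm])
    (fun v => G (v 0) (v 1) (v 2))
  simp_rw [sum_fin_succ_arrow, Fintype.sum_unique] at this
  exact this

lemma integral_four (huniv : IsUniversalHash 4 h) (hmeas : ∀ x, Measurable fun ω => h ω x)
    {x y z w : Fin u} (hxy : x ≠ y) (hxz : x ≠ z) (hxw : x ≠ w) (hyz : y ≠ z) (hyw : y ≠ w)
    (hzw : z ≠ w) (G : Fin p → Fin p → Fin p → Fin p → ℝ) :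
    ∫ ω, G (h ω x) (h ω y) (h ω z) (h ω w)
      = ((p : ℝ) ^ 4)⁻¹ * ∑ a, ∑ b, ∑ c, ∑ d, G a b c d := by
  have := huniv.integral_eq hmeas (j := 4) (by norm_num) (x := ![x, y, z, w])
    (by intro a b; fin_cases a <;> fin_cases b <;>
          simp [hxy, hxy.symm, hxz, hxz.symm, hyz, hyz.symm, hxw, hxw.symm, hyw, hyw.symm,
            hzw, hzw.symm])
    (fun v => G (v 0) (v 1) (v 2) (v 3))
  simp_rw [sum_fin_succ_arrow, Fintype.sum_unique] at this
  exact this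

/-- The mixed second moment of a symmetric kernel with row sums `g`, evaluated at the hash
values of two pairs of distinct keys. -/
lemma integral_kernel_mul (huniv : IsUniversalHash 4 h)
    (hmeas : ∀ x, Measurable fun ω => h ω x) {K : Fin p → Fin p → ℝ}
    (hK : ∀ a b, K a b = K b a) {g : Fin p → ℝ} (hg : ∀ a, ∑ b, K a b = g a) {θ A B : ℝ}
    (hθ : θ = ((p : ℝ) ^ 2)⁻¹ * ∑ a, g a) (hA : A = ((p : ℝ) ^ 3)⁻¹ * ∑ a, g a ^ 2 - θ ^ 2)
    (hB : B = ((p : ℝ) ^ 2)⁻¹ * ∑ a, ∑ b, K a b ^ 2 - θ ^ 2 - 2 * A)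
    {x y z w : Fin u} (hxy : x ≠ y) (hzw : z ≠ w) :
    ∫ ω, K (h ω x) (h ω y) * K (h ω z) (h ω w)
      = θ ^ 2 + A * ((if x = z then 1 else 0) + (if x = w then 1 else 0)
          + (if y = z then 1 else 0) + (if y = w then 1 else 0))
        + B * ((if x = z then 1 else 0) * (if y = w then 1 else 0)
          + (if x = w then 1 else 0) * (if y = z then 1 else 0)) := by
  have two : ∀ {x y : Fin u}, x ≠ y →
      ∫ ω, K (h ω x) (h ω y) * K (h ω x) (h ω y) = θ ^ 2 + 2 * A + B := by
    intro x y hxy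
    rw [huniv.integral_two hmeas hxy fun a b => K a b * K a b, hB]
    simp only [← pow_two]
    ring
  have three : ∀ {x y z : Fin u}, x ≠ y → x ≠ z → y ≠ z →
      ∫ ω, K (h ω x) (h ω y) * K (h ω x) (h ω z) = θ ^ 2 + A := by
    intro x y z hxy hxz hyz
    rw [huniv.integral_three hmeas hxy hxz hyz fun a b c => K a b * K a c, hA]
    simp only [← Finset.mul_sum, ← Finset.sum_mul, hg, ← pow_two]
    ring
  by_cases hxz : x = z
  · subst hxz
    by_cases hyw : y = w
    · subst hyw
      rw [two hxy]
      simp [hxy, hxy.symm]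
      ring
    · rw [three hxy hzw hyw]
      simp [hzw, hxy.symm, hyw]
  by_cases hxw : x = w
  · subst hxw
    simp_rw [hK (h _ z)]
    by_cases hyz : y = z
    · subst hyz
      rw [two hxy]
      simp [hxy, hxy.symm]
      ring
    · rw [three hxy hxz hyz]
      simp [hxz, hxy.symm, hyz]
  simp_rw [hK (h _ x)]
  by_cases hyz : y = z
  · subst hyz
    rw [three hxy.symm hzw hxw]
    simp [hxy, hxw, hzw]
  by_cases hyw : y = w
  · subst hyw
    simp_rw [hK (h _ z)]
    rw [three hxy.symm hyz hxz]
    simp [hxy, hxz, hyz]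
  rw [huniv.integral_four hmeas hxy.symm hyz hyw hxz hxw hzw fun a b c d => K a b * K c d, hθ]
  simp only [← Finset.mul_sum, ← Finset.sum_mul, hg, hxz, hxw, hyz, hyw, if_false]
  ring

end IsUniversalHash

end UniversalHash

section OffDiagonal

variable {ι : Type*} [DecidableEq ι]

/-- The coefficient matrix `f x * f y` with its diagonal removed. -/
def offDiagMul (f : ι → ℝ) (x y : ι) : ℝ := if x = y then 0 else f x * f y

lemma offDiagMul_comm (f : ι → ℝ) (x y : ι) : offDiagMul f x y = offDiagMul f y x := by
  unfold offDiagMul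
  rw [if_congr eq_comm rfl (mul_comm _ _)]

variable [Fintype ι]

lemma sum_offDiagMul (f : ι → ℝ) (x : ι) :
    ∑ y, offDiagMul f x y = f x * (∑ y, f y - f x) := by
  have : ∀ y, offDiagMul f x y = f x * f y - if x = y then f x * f y else 0 := by
    intro y; unfold offDiagMul; split_ifs <;> ring
  simp only [this, Finset.sum_sub_distrib, ← Finset.mul_sum, Finset.sum_ite_eq,
    Finset.mem_univ, if_true]
  ring

lemma sum_sum_offDiagMul (f : ι → ℝ) :
    ∑ x, ∑ y, offDiagMul f x y = (∑ x, f x) ^ 2 - ∑ x, f x ^ 2 := by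
  simp only [sum_offDiagMul, mul_sub, Finset.sum_sub_distrib, ← Finset.sum_mul, pow_two]

lemma sum_sum_offDiagMul_sq (f : ι → ℝ) :
    ∑ x, ∑ y, offDiagMul f x y ^ 2 = (∑ x, f x ^ 2) ^ 2 - ∑ x, f x ^ 4 := by
  have : ∀ x y, offDiagMul f x y ^ 2 = offDiagMul (fun x => f x ^ 2) x y := by
    intro x y; unfold offDiagMul; split_ifs <;> ring
  simp only [this, sum_sum_offDiagMul, ← pow_mul]

lemma sum_mul_mul_incidence {w : ι → ι → ℝ} (hw : ∀ x y, w x y = w y x) (T A B : ℝ) :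
    ∑ x, ∑ y, ∑ z, ∑ t, w x y * w z t *
      (T + A * ((if x = z then 1 else 0) + (if x = t then 1 else 0)
          + (if y = z then 1 else 0) + (if y = t then 1 else 0))
        + B * ((if x = z then 1 else 0) * (if y = t then 1 else 0)
          + (if x = t then 1 else 0) * (if y = z then 1 else 0)))
      = T * (∑ x, ∑ y, w x y) ^ 2 + 4 * A * ∑ x, (∑ y, w x y) ^ 2
        + 2 * B * ∑ x, ∑ y, w x y ^ 2 := by
  have e0 : ∑ x, ∑ y, ∑ z, ∑ t, w x y * w z t = (∑ x, ∑ y, w x y) ^ 2 := by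
    simp only [← Finset.mul_sum, ← Finset.sum_mul, pow_two]
  have e1 : ∑ x, ∑ y, ∑ z, ∑ t, w x y * w z t * (if x = z then 1 else 0)
      = ∑ x, (∑ y, w x y) ^ 2 := by
    simp only [mul_ite, mul_one, mul_zero, Finset.sum_ite_irrel, Finset.sum_const_zero,
      Finset.sum_ite_eq, Finset.mem_univ, if_true, ← Finset.mul_sum, ← Finset.sum_mul, pow_two]
  have e2 : ∑ x, ∑ y, ∑ z, ∑ t, w x y * w z t * (if x = t then 1 else 0)
      = ∑ x, (∑ y, w x y) ^ 2 := by
    rw [← e1]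
    refine Finset.sum_congr rfl fun x _ => Finset.sum_congr rfl fun y _ => ?_
    rw [Finset.sum_comm]
    simp only [hw]
  have e3 : ∑ x, ∑ y, ∑ z, ∑ t, w x y * w z t * (if y = z then 1 else 0)
      = ∑ x, (∑ y, w x y) ^ 2 := by
    rw [← e1, Finset.sum_comm]
    refine Finset.sum_congr rfl fun x _ => Finset.sum_congr rfl fun y _ => ?_
    rw [hw]
  have e4 : ∑ x, ∑ y, ∑ z, ∑ t, w x y * w z t * (if y = t then 1 else 0)
      = ∑ x, (∑ y, w x y) ^ 2 := by
    rw [← e2, Finset.sum_comm]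
    refine Finset.sum_congr rfl fun x _ => Finset.sum_congr rfl fun y _ => ?_
    rw [hw]
  have e5 : ∑ x, ∑ y, ∑ z, ∑ t, w x y * w z t *
      ((if x = z then 1 else 0) * (if y = t then 1 else 0)) = ∑ x, ∑ y, w x y ^ 2 := by
    simp only [mul_ite, mul_one, mul_zero, Finset.sum_ite_eq, Finset.mem_univ, if_true,
      pow_two]
  have e6 : ∑ x, ∑ y, ∑ z, ∑ t, w x y * w z t *
      ((if x = t then 1 else 0) * (if y = z then 1 else 0)) = ∑ x, ∑ y, w x y ^ 2 := by
    rw [← e5]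
    refine Finset.sum_congr rfl fun x _ => Finset.sum_congr rfl fun y _ => ?_
    rw [Finset.sum_comm]
    simp only [hw]
  calc _ = ∑ x, ∑ y, ∑ z, ∑ t, (T * (w x y * w z t)
        + A * (w x y * w z t * (if x = z then 1 else 0))
        + A * (w x y * w z t * (if x = t then 1 else 0))
        + A * (w x y * w z t * (if y = z then 1 else 0))
        + A * (w x y * w z t * (if y = t then 1 else 0))
        + B * (w x y * w z t * ((if x = z then 1 else 0) * (if y = t then 1 else 0)))
        + B * (w x y * w z t * ((if x = t then 1 else 0) * (if y = z then 1 else 0)))) := by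
        refine Finset.sum_congr rfl fun x _ => Finset.sum_congr rfl fun y _ =>
          Finset.sum_congr rfl fun z _ => Finset.sum_congr rfl fun t _ => ?_
        ring
    _ = _ := by
        rw [← e0]
        simp only [Finset.sum_add_distrib, ← Finset.mul_sum, e1, e2, e3, e4, e5, e6]
        ring

end OffDiagonal

section QuadraticForm

variable {Ω : Type*} [MeasureSpace Ω] [IsProbabilityMeasure (ℙ : Measure Ω)] {u p : ℕ}
  {h : Ω → Fin u → Fin p}

namespace IsUniversalHash

lemma integral_offDiagonal_form (huniv : IsUniversalHash 4 h)
    (hmeas : ∀ x, Measurable fun ω => h ω x) {K : Fin p → Fin p → ℝ} {θ : ℝ}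
    (hθ : θ = ((p : ℝ) ^ 2)⁻¹ * ∑ a, ∑ b, K a b) (f : Fin u → ℝ) :
    ∫ ω, ∑ x, ∑ y, offDiagMul f x y * K (h ω x) (h ω y)
      = θ * ((∑ x, f x) ^ 2 - ∑ x, f x ^ 2) := by
  have hm : Measurable h := measurable_pi_lambda _ hmeas
  rw [integral_finsetSum _ fun x _ => integrable_comp_of_fintype hm
    (fun v => ∑ y, offDiagMul f x y * K (v x) (v y)), ← sum_sum_offDiagMul, Finset.mul_sum]
  refine Finset.sum_congr rfl fun x _ => ?_
  rw [integral_finsetSum _ fun y _ => integrable_comp_of_fintype hm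
    (fun v => offDiagMul f x y * K (v x) (v y)), Finset.mul_sum]
  refine Finset.sum_congr rfl fun y _ => ?_
  rw [integral_const_mul]
  by_cases hxy : x = y
  · simp [offDiagMul, hxy]
  · rw [huniv.integral_two hmeas hxy K, hθ, mul_comm]

lemma variance_offDiagonal_form (huniv : IsUniversalHash 4 h)
    (hmeas : ∀ x, Measurable fun ω => h ω x) {K : Fin p → Fin p → ℝ}
    (hK : ∀ a b, K a b = K b a) {g : Fin p → ℝ} (hg : ∀ a, ∑ b, K a b = g a) {θ A B : ℝ}
    (hθ : θ = ((p : ℝ) ^ 2)⁻¹ * ∑ a, g a) (hA : A = ((p : ℝ) ^ 3)⁻¹ * ∑ a, g a ^ 2 - θ ^ 2)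
    (hB : B = ((p : ℝ) ^ 2)⁻¹ * ∑ a, ∑ b, K a b ^ 2 - θ ^ 2 - 2 * A) (f : Fin u → ℝ) :
    variance (fun ω => ∑ x, ∑ y, offDiagMul f x y * K (h ω x) (h ω y)) ℙ
      = 4 * A * ∑ x, f x ^ 2 * (∑ y, f y - f x) ^ 2
        + 2 * B * ((∑ x, f x ^ 2) ^ 2 - ∑ x, f x ^ 4) := by
  have hm : Measurable h := measurable_pi_lambda _ hmeas
  have hmem : MemLp (fun ω => ∑ x, ∑ y, offDiagMul f x y * K (h ω x) (h ω y)) 2 ℙ :=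
    (MemLp.of_discrete (μ := Measure.map h ℙ)
      (f := fun v => ∑ x, ∑ y, offDiagMul f x y * K (v x) (v y))).comp_of_map hm.aemeasurable
  rw [variance_eq_sub hmem,
    huniv.integral_offDiagonal_form hmeas (K := K) (θ := θ) (by simp only [hg, hθ])]
  have key : ∫ ω, (∑ x, ∑ y, offDiagMul f x y * K (h ω x) (h ω y)) ^ 2
      = θ ^ 2 * (∑ x, ∑ y, offDiagMul f x y) ^ 2 + 4 * A * ∑ x, (∑ y, offDiagMul f x y) ^ 2
        + 2 * B * ∑ x, ∑ y, offDiagMul f x y ^ 2 := by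
    rw [← sum_mul_mul_incidence (offDiagMul_comm f)]
    have expand : ∀ v : Fin u → Fin p,
        (∑ x, ∑ y, offDiagMul f x y * K (v x) (v y)) ^ 2
          = ∑ x, ∑ y, ∑ z, ∑ t, offDiagMul f x y * offDiagMul f z t
              * (K (v x) (v y) * K (v z) (v t)) := by
      intro v
      simp only [pow_two, Finset.sum_mul, Finset.mul_sum]
      refine Finset.sum_congr rfl fun x _ => Finset.sum_congr rfl fun y _ =>
        Finset.sum_congr rfl fun z _ => Finset.sum_congr rfl fun t _ => ?_
      ring
    simp only [expand]
    rw [integral_finsetSum _ fun x _ => integrable_comp_of_fintype hm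
      (fun v => ∑ y, ∑ z, ∑ t, offDiagMul f x y * offDiagMul f z t
        * (K (v x) (v y) * K (v z) (v t)))]
    refine Finset.sum_congr rfl fun x _ => ?_
    rw [integral_finsetSum _ fun y _ => integrable_comp_of_fintype hm
      (fun v => ∑ z, ∑ t, offDiagMul f x y * offDiagMul f z t
        * (K (v x) (v y) * K (v z) (v t)))]
    refine Finset.sum_congr rfl fun y _ => ?_
    rw [integral_finsetSum _ fun z _ => integrable_comp_of_fintype hm
      (fun v => ∑ t, offDiagMul f x y * offDiagMul f z t * (K (v x) (v y) * K (v z) (v t)))]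
    refine Finset.sum_congr rfl fun z _ => ?_
    rw [integral_finsetSum _ fun t _ => integrable_comp_of_fintype hm
      (fun v => offDiagMul f x y * offDiagMul f z t * (K (v x) (v y) * K (v z) (v t)))]
    refine Finset.sum_congr rfl fun t _ => ?_
    rw [integral_const_mul]
    by_cases hxy : x = y
    · simp [offDiagMul, hxy]
    by_cases hzt : z = t
    · simp [offDiagMul, hzt]
    rw [huniv.integral_kernel_mul hmeas hK hg hθ hA hB hxy hzt]
  simp only [Pi.pow_apply]
  rw [key, sum_sum_offDiagMul, sum_sum_offDiagMul_sq]
  simp only [sum_offDiagMul, mul_pow]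
  ring

end IsUniversalHash

end QuadraticForm

section Moments

variable {ι : Type*} [Fintype ι]

lemma sq_sum_le_card_support_mul (f : ι → ℝ) :
    (∑ x, f x) ^ 2 ≤ ((Finset.univ.filter fun y => f y ≠ 0).card : ℝ) * ∑ x, f x ^ 2 := by
  rw [← Finset.sum_filter_ne_zero]
  refine sq_sum_le_card_mul_sum_sq.trans ?_
  refine mul_le_mul_of_nonneg_left ?_ (Nat.cast_nonneg _)
  exact Finset.sum_le_univ_sum_of_nonneg fun x => sq_nonneg _

variable [DecidableEq ι]

lemma sq_sum_sub_le (f : ι → ℝ) {x : ι} (hx : f x ≠ 0) :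
    (∑ y, f y - f x) ^ 2
      ≤ (((Finset.univ.filter fun y => f y ≠ 0).card : ℝ) - 1) * (∑ y, f y ^ 2 - f x ^ 2) := by
  set S := Finset.univ.filter fun y => f y ≠ 0
  have hxS : x ∈ S := by simp [S, hx]
  have h1 : ∑ y, f y - f x = ∑ y ∈ S.erase x, f y := by
    rw [← Finset.sum_filter_ne_zero, ← Finset.add_sum_erase S f hxS]; ring
  have h2 : ∑ y, f y ^ 2 - f x ^ 2 = ∑ y ∈ S.erase x, f y ^ 2 := by
    rw [← Finset.sum_filter_ne_zero]
    have : (Finset.univ.filter fun y => f y ^ 2 ≠ 0) = S := by simp [S]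
    rw [this, ← Finset.add_sum_erase S (fun y => f y ^ 2) hxS]; ring
  have h3 : ((S.erase x).card : ℝ) = (S.card : ℝ) - 1 := by
    rw [Finset.card_erase_of_mem hxS, Nat.cast_pred (Finset.card_pos.2 ⟨x, hxS⟩)]
  rw [h1, h2, ← h3]
  exact sq_sum_le_card_mul_sum_sq

lemma sum_sq_mul_sq_sum_sub_le (f : ι → ℝ) :
    ∑ x, f x ^ 2 * (∑ y, f y - f x) ^ 2
      ≤ (((Finset.univ.filter fun y => f y ≠ 0).card : ℝ) - 1)
        * ((∑ x, f x ^ 2) ^ 2 - ∑ x, f x ^ 4) := by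
  have h : (∑ x, f x ^ 2) ^ 2 - ∑ x, f x ^ 4
      = ∑ x, f x ^ 2 * (∑ y, f y ^ 2 - f x ^ 2) := by
    simp only [mul_sub, Finset.sum_sub_distrib, ← Finset.sum_mul, ← pow_two]
    simp only [← pow_mul, Nat.reduceMul]
  rw [h, Finset.mul_sum]
  refine Finset.sum_le_sum fun x _ => ?_
  by_cases hx : f x = 0
  · simp [hx]
  · rw [mul_left_comm]
    exact mul_le_mul_of_nonneg_left (sq_sum_sub_le f hx) (sq_nonneg _)

lemma sum_sq_le_of_card_support_le_one (f : ι → ℝ)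
    (hf : (Finset.univ.filter fun y => f y ≠ 0).card ≤ 1) :
    ∑ x, f x ^ 2 ≤ (∑ x, f x) ^ 2 := by
  have hz : ∀ x y, offDiagMul f x y = 0 := by
    intro x y
    unfold offDiagMul
    split_ifs with hxy
    · rfl
    · by_contra hne
      exact hxy (Finset.card_le_one.1 hf x (by simp [left_ne_zero_of_mul hne]) y
        (by simp [right_ne_zero_of_mul hne]))
  have := sum_sum_offDiagMul f
  simp only [hz, Finset.sum_const_zero] at this
  linarith

lemma abs_sq_sum_sub_sum_sq_le (f : ι → ℝ)
    (hf : 1 ≤ (Finset.univ.filter fun y => f y ≠ 0).card) :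
    |(∑ x, f x) ^ 2 - ∑ x, f x ^ 2|
      ≤ (∑ x, f x ^ 2) * (((Finset.univ.filter fun y => f y ≠ 0).card : ℝ) - 1) := by
  have h1 := sq_sum_le_card_support_mul f
  have h0 : 0 ≤ ∑ x, f x ^ 2 := Finset.sum_nonneg fun x _ => sq_nonneg _
  rw [abs_le]
  refine ⟨?_, by linarith⟩
  rcases hf.lt_or_eq with h2 | h2
  · have : (2 : ℝ) ≤ ((Finset.univ.filter fun y => f y ≠ 0).card : ℝ) := by exact_mod_cast h2
    nlinarith [sq_nonneg (∑ x, f x)]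
  · have := sum_sq_le_of_card_support_le_one f h2.ge
    rw [← h2]
    norm_num
    exact this

end Moments


/-- The numerical inequality behind the variance bound, with `F = F₂`, `D = F₂² - F₄`,
`S = ∑ f(x)² (F₁ - f(x))²` and `p = 2 r k - 1`. -/
lemma variance_bound {r k n p F D S A B : ℝ} (hr : 2 ≤ r) (hk : 2 ≤ k) (hn1 : 1 ≤ n)
    (hn2 : n = 1 ∨ 2 ≤ n) (hnr : n ≤ r * k) (hp : p = 2 * (r * k) - 1) (hF : 0 < F)
    (hD0 : 0 ≤ D) (hD : n * D ≤ (n - 1) * F ^ 2) (hS : S ≤ (n - 1) * D)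
    (hA : A = (p ^ 3)⁻¹ * (2 * k - 1) - ((p ^ 2)⁻¹) ^ 2)
    (hB : B = (p ^ 2)⁻¹ * (2 * k * p - (2 * k - 1)) - ((p ^ 2)⁻¹) ^ 2 - 2 * A) :
    4 * A * S + 2 * B * D < 2 * F ^ 2 / r := by
  have hrk : 4 ≤ r * k := by nlinarith
  have hr2 : 2 * r ≤ r * k := by nlinarith
  have hp7 : 7 ≤ p := by linarith
  have hp0 : 0 < p := by linarith
  have hA' : A * p ^ 4 = (2 * k - 1) * p - 1 := by rw [hA]; field_simp
  have hA0 : 0 ≤ A := by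
    have : 0 ≤ A * p ^ 4 := by rw [hA']; nlinarith
    exact nonneg_of_mul_nonneg_left this (by positivity)
  have hstep : 4 * A * S + 2 * B * D ≤ 2 * D * (2 * A * (n - 1) + B) := by
    nlinarith [mul_le_mul_of_nonneg_left hS hA0]
  refine hstep.trans_lt ?_
  rw [lt_div_iff₀ (by linarith)]
  rcases hn2 with rfl | hn2
  · have : D = 0 := by linarith
    subst this
    nlinarith [sq_pos_of_pos hF]
  set E := 2 * A * (n - 1) + B with hE
  have hE' : E * p ^ 4
      = (2 * k * p - (2 * k - 1)) * p ^ 2 - 1 + 2 * (n - 2) * ((2 * k - 1) * p - 1) := by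
    rw [← hA', hE, hB]; field_simp; ring
  have hrE : r * (E * p ^ 4)
      = p ^ 4 + (r - 1) * p ^ 2 - r + 2 * (n - 2) * ((p + 1 - r) * p - r) := by
    rw [hE', hp]; ring
  have hrE2 : r * (E * p ^ 4) ≤ p ^ 4 + (r - 1 + 2 * (n - 2)) * p ^ 2 := by
    rw [hrE]
    have : (p + 1 - r) * p - r ≤ p ^ 2 := by nlinarith
    nlinarith [mul_le_mul_of_nonneg_left this (by linarith : 0 ≤ 2 * (n - 2))]
  have hsmall : (n - 1) * (r - 1 + 2 * (n - 2)) < p ^ 2 := by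
    have h1 : n - 1 ≤ (p - 1) / 2 := by linarith
    have h2 : r - 1 + 2 * (n - 2) ≤ 5 * (p - 3) / 4 := by linarith
    calc _ ≤ (p - 1) / 2 * (5 * (p - 3) / 4) :=
          mul_le_mul h1 h2 (by linarith) (by linarith)
      _ < p ^ 2 := by nlinarith
  have hEn : (n - 1) * (r * E) < n := by
    have hp4 : 0 < p ^ 4 := by positivity
    refine lt_of_mul_lt_mul_right (a := p ^ 4) ?_ hp4.le
    have h1 := mul_le_mul_of_nonneg_left hrE2 (by linarith : 0 ≤ n - 1)
    have h2 := mul_lt_mul_of_pos_right hsmall (by positivity : 0 < p ^ 2)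
    linarith
  have hF2 : 0 < F ^ 2 := by positivity
  rcases le_or_gt (r * E) 0 with h0 | h0
  · have := mul_nonneg hD0 (neg_nonneg.2 h0)
    linarith
  have h1 := mul_le_mul_of_nonneg_right hD h0.le
  have h2 := mul_lt_mul_of_pos_right hEn hF2
  have h3 : n * (D * (r * E)) < n * F ^ 2 := by linarith
  have h4 := lt_of_mul_lt_mul_left h3 (by linarith)
  linarith

/-- Expanding the squared bucket sums into a diagonal part and an off-diagonal form. -/
lemma sum_sq_buckets {ι : Type*} [Fintype ι] [DecidableEq ι] {M r : ℕ} (hr : 0 < r)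
    (f : ι → ℝ) (v : ι → ℕ) (hv : ∀ x, v x < 2 * M) :
    ∑ j ∈ Finset.range r,
        (∑ x, hashSign M (v x) * f x * (if v x % r = j then 1 else 0)) ^ 2
      = ∑ x, f x ^ 2 + ∑ x, ∑ y, offDiagMul f x y * signedCollision M r (v x) (v y) := by
  have h1 : ∀ x y, ∑ j ∈ Finset.range r,
      hashSign M (v x) * f x * (if v x % r = j then 1 else 0)
        * (hashSign M (v y) * f y * (if v y % r = j then 1 else 0))
      = f x * f y * signedCollision M r (v x) (v y) := by
    intro x y
    rw [Finset.sum_eq_single_of_mem (v x % r) (Finset.mem_range.2 (Nat.mod_lt _ hr))]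
    · rw [signedCollision, if_pos rfl, if_congr (eq_comm (a := v y % r)) rfl rfl]
      ring
    · intro j _ hj
      simp [hj.symm]
  have h2 : ∀ x y, f x * f y * signedCollision M r (v x) (v y)
      = (if x = y then f x ^ 2 else 0)
        + offDiagMul f x y * signedCollision M r (v x) (v y) := by
    intro x y
    by_cases hxy : x = y
    · subst hxy
      have := hashSign_sq (hv x)
      simp [offDiagMul, signedCollision, ← pow_two, this]
    · simp [offDiagMul, hxy]
  calc _ = ∑ x, ∑ y, ∑ j ∈ Finset.range r,
      hashSign M (v x) * f x * (if v x % r = j then 1 else 0)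
        * (hashSign M (v y) * f y * (if v y % r = j then 1 else 0)) := by
        simp only [pow_two, Finset.sum_mul_sum]
        rw [Finset.sum_comm]
        exact Finset.sum_congr rfl fun x _ => Finset.sum_comm
    _ = _ := by
        simp only [h1, h2, Finset.sum_add_distrib, Finset.sum_ite_eq, Finset.mem_univ, if_true]

/-- Theorem 1 (two-for-one Count Sketch with a Mersenne prime): with `r = 2^ℓ > 1` and
`u > r` powers of two, `p = 2^b - 1 > u` a prime, `h : [u] → [p]` a 4-universal random
hash function, `i(x) = h(x) mod 2^ℓ`, `s(x) = 1 - 2⌊h(x)/2^(b-1)⌋`, the Count Sketch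
second-moment estimator `X` satisfies `E[X] = F₂ + (F₁² - F₂)/p²`,
`|E[X] - F₂| ≤ F₂(n-1)/p²` and `Var[X] < 2F₂²/r`. -/
theorem stmt0
    {Ω : Type*} [MeasureSpace Ω] [IsProbabilityMeasure (ℙ : Measure Ω)]
    (b ℓ u p r : ℕ)
    (hr : r = 2 ^ ℓ) (hr1 : 1 < r)
    (hu : ∃ m : ℕ, u = 2 ^ m) (hru : r < u)
    (hp : p = 2 ^ b - 1) (hup : u < p) (hprime : Nat.Prime p)
    (h : Ω → Fin u → Fin p)
    (hmeas : ∀ x : Fin u, Measurable fun ω => h ω x)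
    (huniv : ∀ j : ℕ, j ≤ 4 → ∀ x : Fin j → Fin u, Function.Injective x →
      ∀ y : Fin j → Fin p,
        ℙ {ω | ∀ m : Fin j, h ω (x m) = y m} = (p : ENNReal)⁻¹ ^ j)
    (i : Ω → Fin u → ℕ) (hi : ∀ ω x, i ω x = (h ω x : ℕ) % 2 ^ ℓ)
    (s : Ω → Fin u → ℝ)
    (hs : ∀ ω x, s ω x = 1 - 2 * (((h ω x : ℕ) / 2 ^ (b - 1) : ℕ) : ℝ))
    (f : Fin u → ℤ)
    (X : Ω → ℝ)
    (hX : ∀ ω, X ω = ∑ j ∈ Finset.range r,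
      (∑ x : Fin u, s ω x * (f x : ℝ) * (if i ω x = j then 1 else 0)) ^ 2)
    (F₁ F₂ : ℝ) (hF₁ : F₁ = ∑ x : Fin u, (f x : ℝ))
    (hF₂ : F₂ = ∑ x : Fin u, (f x : ℝ) ^ 2)
    (n : ℕ) (hn : n = (Finset.univ.filter fun x => f x ≠ 0).card) (hn1 : 1 ≤ n) :
    (∫ ω, X ω) = F₂ + (F₁ ^ 2 - F₂) / (p : ℝ) ^ 2 ∧
    |(∫ ω, X ω) - F₂| ≤ F₂ * ((n : ℝ) - 1) / (p : ℝ) ^ 2 ∧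
    variance X ℙ < 2 * F₂ ^ 2 / (r : ℝ) := by
  have huniv' : IsUniversalHash 4 h := huniv
  have hr0 : 0 < r := by omega
  have hup' : u < 2 ^ b - 1 := hp ▸ hup
  have hru' : 2 ^ ℓ < u := hr ▸ hru
  obtain ⟨m, rfl⟩ := hu
  have hmb : m < b := (Nat.pow_lt_pow_iff_right one_lt_two).1 (by omega : 2 ^ m < 2 ^ b)
  have hℓm : ℓ < m := (Nat.pow_lt_pow_iff_right one_lt_two).1 hru'
  set M := 2 ^ (b - 1) with hMdef
  have hM2 : 2 ^ b = 2 * M := by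
    rw [hMdef, ← pow_succ']; congr 1; omega
  have hM0 : 0 < M := by positivity
  have huM : 2 ^ m ≤ M := Nat.pow_le_pow_right (by norm_num) (by omega)
  obtain ⟨k, hk⟩ : ∃ k, k = 2 ^ (b - 1 - ℓ) := ⟨_, rfl⟩
  have hM : M = r * k := by
    rw [hr, hk, hMdef, ← pow_add]; congr 1; omega
  have hk2 : 2 ≤ k := by
    rw [hk]; exact Nat.le_self_pow (by omega) 2
  have hpM : p + 1 = 2 * M := by omega
  set φ : Fin (2 ^ m) → ℝ := fun x => (f x : ℝ) with hφ
  set K : Fin p → Fin p → ℝ := fun a c => signedCollision M r a c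
  set g : Fin p → ℝ := fun a => hashSign M a * if (a : ℕ) % r = r - 1 then 1 else 0
  have hXeq : X = fun ω =>
      F₂ + ∑ x, ∑ y, offDiagMul φ x y * K (h ω x) (h ω y) := by
    funext ω
    rw [hX, hF₂, ← sum_sq_buckets hr0 φ (fun x => (h ω x : ℕ))
      fun x => by have := (h ω x).2; omega]
    simp only [hs, hi, hashSign, ← hr, hφ]
  have hg : ∀ a, ∑ c, K a c = g a := fun a =>
    (Fin.sum_univ_eq_sum_range (fun c => signedCollision M r a c) p).trans
      (sum_signedCollision hM hM0 hpM a)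
  have hgsum : ∑ a, g a = 1 := by
    have := sum_hashSign_mod_eq (c := r - 1) hM hM0 hpM
    rw [if_pos rfl] at this
    rw [← this]
    exact Fin.sum_univ_eq_sum_range
      (fun a => hashSign M a * if a % r = r - 1 then (1 : ℝ) else 0) p
  have hgsq : ∑ a, g a ^ 2 = 2 * k - 1 := by
    have := sum_range_pred_mod_eq (c := r - 1) hM hM0 hpM (by omega)
    rw [if_pos rfl] at this
    rw [← this, ← Fin.sum_univ_eq_sum_range
      (fun a => if a % r = r - 1 then (1 : ℝ) else 0)]
    refine Finset.sum_congr rfl fun a _ => ?_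
    simp only [g]
    rw [mul_pow, hashSign_sq (by have := a.2; omega)]
    simp
  have hKsq : ∑ a, ∑ c, K a c ^ 2 = 2 * k * p - (2 * k - 1) := by
    rw [← sum_signedCollision_sq hM hM0 hpM, ← Fin.sum_univ_eq_sum_range
      (fun a => ∑ c ∈ Finset.range p, signedCollision M r a c ^ 2)]
    exact Finset.sum_congr rfl fun a _ =>
      Fin.sum_univ_eq_sum_range (fun c => signedCollision M r a c ^ 2) p
  have hmh : Measurable h := measurable_pi_lambda _ hmeas
  have hYint : Integrable fun ω => ∑ x, ∑ y, offDiagMul φ x y * K (h ω x) (h ω y) :=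
    integrable_comp_of_fintype hmh fun v => ∑ x, ∑ y, offDiagMul φ x y * K (v x) (v y)
  have hmean : ∫ ω, X ω = F₂ + (F₁ ^ 2 - F₂) / (p : ℝ) ^ 2 := by
    rw [hXeq, integral_add (integrable_const _) hYint,
      huniv'.integral_offDiagonal_form hmeas rfl]
    simp only [hg, hgsum, hF₁, hF₂, hφ, integral_const, probReal_univ, one_smul]
    ring
  have hsupp : (Finset.univ.filter fun x => φ x ≠ 0).card = n := by
    rw [hn]; simp only [hφ, ne_eq, Int.cast_eq_zero]
  have hsupp_sq : (Finset.univ.filter fun x => φ x ^ 2 ≠ 0).card = n := by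
    rw [← hsupp]; simp only [ne_eq, pow_eq_zero_iff two_ne_zero]
  refine ⟨hmean, ?_, ?_⟩
  · have := abs_sq_sum_sub_sum_sq_le φ (by omega)
    rw [hsupp] at this
    rw [hmean, add_sub_cancel_left, abs_div, abs_of_nonneg (sq_nonneg (p : ℝ)), hF₁, hF₂]
    gcongr
  · have hY := hYint.aestronglyMeasurable
    rw [hXeq, variance_const_add hY, huniv'.variance_offDiagonal_form hmeas
      (fun a c => signedCollision_comm M r a c) hg rfl rfl rfl, hgsum, hgsq, hKsq, mul_one]
    have hS := sum_sq_mul_sq_sum_sub_le φ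
    have hF4 := sq_sum_le_card_support_mul fun x => φ x ^ 2
    rw [hsupp] at hS
    rw [hsupp_sq] at hF4
    simp only [← pow_mul] at hF4
    have hnM : n ≤ r * k := by
      rw [← hM, ← hsupp]
      exact (Finset.card_le_univ _).trans (by simpa using huM)
    have hpR : (p : ℝ) = 2 * (r * k) - 1 := by
      have : ((p + 1 : ℕ) : ℝ) = ((2 * M : ℕ) : ℝ) := by rw [hpM]
      rw [hM] at this
      push_cast at this
      linarith
    have hFpos : 0 < ∑ x, φ x ^ 2 := by
      obtain ⟨x, hx⟩ := Finset.card_pos.1 (by omega : 0 < (Finset.univ.filter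
        fun x => φ x ≠ 0).card)
      exact Finset.sum_pos' (fun y _ => sq_nonneg _)
        ⟨x, Finset.mem_univ x, sq_pos_of_ne_zero (Finset.mem_filter.1 hx).2⟩
    have hD0 : 0 ≤ (∑ x, φ x ^ 2) ^ 2 - ∑ x, φ x ^ 4 := by
      rw [← sum_sum_offDiagMul_sq]
      exact Finset.sum_nonneg fun x _ => Finset.sum_nonneg fun y _ => sq_nonneg _
    have hF₂' : F₂ = ∑ x, φ x ^ 2 := hF₂
    rw [hF₂']
    refine variance_bound (n := n) (k := k) (p := p) (by exact_mod_cast hr1)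
      (by exact_mod_cast hk2) (by exact_mod_cast hn1) ?_ (by exact_mod_cast hnM) hpR hFpos
      hD0 (by linarith) hS rfl rfl
    rcases hn1.eq_or_lt with h1 | h1
    · exact Or.inl (by rw [← h1]; norm_num)
    · exact Or.inr (by exact_mod_cast h1)
end

section
/- Let q > c > 0 and n ≥ 1 be integers, and let x ≥ 0 be an integer satisfying x·c^{n−1} ≤ q^n − c^n if c divides q, and x·c^{n−1} ≤ q^{n−1}(q − c) otherwise. Define the sequence v₀ = 0 and v_{i+1} = ⌊((v_i + 1)·c + x)/q⌋ for i = 0,...,n−1. Then v_n = ⌊x/(q − c)⌋. -/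
/-- One step of the recurrence, measured by its distance from `x / (q - c)`. -/
lemma lt_step {q c x w w' : ℕ} (hcq : c < q) (h : w' = ((w + 1) * c + x) / q) :
    (((x / (q - c) : ℕ) : ℤ) - w' - 1) * q < (((x / (q - c) : ℕ) : ℤ) - w - 1) * c := by
  have h₁ : (w + 1) * c + x < (w' + 1) * q := by
    rw [h, mul_comm _ q]
    exact Nat.lt_mul_div_succ _ (Nat.zero_lt_of_lt hcq)
  have h₂ : x / (q - c) * (q - c) ≤ x := Nat.div_mul_le_self _ _
  zify [hcq.le] at h₁ h₂ ⊢
  linarith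

lemma step_le {q c x w : ℕ} (hcq : c < q) (hw : w ≤ x / (q - c)) :
    ((w + 1) * c + x) / q ≤ x / (q - c) := by
  rw [← Nat.lt_succ_iff, Nat.div_lt_iff_lt_mul (by lia)]
  have h₁ : x < (q - c) * (x / (q - c) + 1) := Nat.lt_mul_div_succ _ (by lia)
  have h₂ : (w + 1) * c ≤ (x / (q - c) + 1) * c := by gcongr
  simp only [Nat.succ_eq_add_one]
  zify [hcq.le] at h₁ h₂ ⊢
  linarith

/-- The geometric bound on the error when `q = c * k`. -/
lemma le_add_geom_sum {c k n x : ℕ} (hc : 0 < c) (hcq : c < c * k)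
    {v : ℕ → ℕ} (hvs : ∀ i, v (i + 1) = ((v i + 1) * c + x) / (c * k))
    (h0 : x / (c * k - c) ≤ v 0 + ∑ j ∈ Finset.range n, k ^ j) {i m : ℕ} (him : i + m = n) :
    x / (c * k - c) ≤ v i + ∑ j ∈ Finset.range m, k ^ j := by
  induction i generalizing m with
  | zero => simpa [← him] using h0
  | succ i ih =>
    have h := ih (m := m + 1) (by lia)
    have hs := lt_step hcq (hvs i)
    rw [geom_sum_succ] at h
    generalize ∑ j ∈ Finset.range m, k ^ j = S at h ⊢
    generalize x / (c * k - c) = a at h hs ⊢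
    zify at h hc hcq ⊢
    push_cast at hs
    have hs' : ((a : ℤ) - v (i + 1) - 1) * (c * k) < S * (c * k) := by nlinarith
    have := lt_of_mul_lt_mul_right hs' (by positivity)
    linarith

lemma sub_mul_pow_le {q c x : ℕ} (hcq : c < q) {v : ℕ → ℕ}
    (hvs : ∀ i, v (i + 1) = ((v i + 1) * c + x) / q) (i : ℕ) :
    (((x / (q - c) : ℕ) : ℤ) - v i - 1) * q ^ i ≤
      (((x / (q - c) : ℕ) : ℤ) - v 0 - 1) * c ^ i := by
  induction i with
  | zero => simp
  | succ i ih =>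
    calc _ = (((x / (q - c) : ℕ) : ℤ) - v (i + 1) - 1) * q * q ^ i := by ring
      _ ≤ (((x / (q - c) : ℕ) : ℤ) - v i - 1) * c * q ^ i := by
        have := (lt_step hcq (hvs i)).le
        gcongr
      _ = (((x / (q - c) : ℕ) : ℤ) - v i - 1) * q ^ i * c := by ring
      _ ≤ (((x / (q - c) : ℕ) : ℤ) - v 0 - 1) * c ^ i * c := by gcongr
      _ = _ := by ring

/-- Theorem 8 (division with generalized Mersenne numbers): given integers
`q > c > 0`, `n ≥ 1` and `x ≥ 0` with `x·c^(n-1) ≤ q^n - c^n` if `c ∣ q` and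
`x·c^(n-1) ≤ q^(n-1)(q-c)` otherwise, the sequence `v₀ = 0`,
`v_{i+1} = ⌊((v_i + 1)c + x)/q⌋` satisfies `v_n = ⌊x/(q-c)⌋`. -/
theorem stmt11 (q c n x : ℕ) (hc : 0 < c) (hcq : c < q) (hn : 1 ≤ n)
    (hx : if c ∣ q then x * c ^ (n - 1) ≤ q ^ n - c ^ n
          else x * c ^ (n - 1) ≤ q ^ (n - 1) * (q - c))
    (v : ℕ → ℕ) (hv0 : v 0 = 0)
    (hvs : ∀ i : ℕ, v (i + 1) = ((v i + 1) * c + x) / q) :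
    v n = x / (q - c) := by
  have hle : ∀ i, v i ≤ x / (q - c) := by
    intro i
    induction i with
    | zero => simp [hv0]
    | succ i ih => rw [hvs]; exact step_le hcq ih
  refine (hle n).antisymm ?_
  obtain ⟨n, rfl⟩ : ∃ m, n = m + 1 := ⟨n - 1, by lia⟩
  rw [Nat.add_sub_cancel] at hx
  split_ifs at hx with hd
  · obtain ⟨k, rfl⟩ := hd
    have hk : 1 < k := by
      by_contra! hk
      nlinarith
    suffices h0 : x / (c * k - c) ≤ v 0 + ∑ j ∈ Finset.range (n + 1), k ^ j by
      simpa using le_add_geom_sum hc hcq hvs h0 (i := n + 1) (m := 0) rfl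
    rw [hv0, zero_add]
    apply Nat.div_le_of_le_mul
    have hg : (∑ j ∈ Finset.range (n + 1), (k : ℤ) ^ j) * (k - 1) = k ^ (n + 1) - 1 :=
      geom_sum_mul _ _
    have hp : c ^ (n + 1) ≤ (c * k) ^ (n + 1) := by gcongr
    zify [hcq.le, hp] at hx hc ⊢
    have hx' : (x : ℤ) * c ^ n ≤ (c * (k ^ (n + 1) - 1)) * c ^ n := by
      refine hx.trans_eq ?_
      ring
    have := le_of_mul_le_mul_right hx' (by positivity)
    rw [← hg] at this
    linarith
  · have h := sub_mul_pow_le hcq hvs n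
    have hs := lt_step hcq (hvs n)
    have ha : x / (q - c) * c ^ n ≤ q ^ n := by
      refine Nat.le_of_mul_le_mul_right (c := q - c) ?_ (by lia)
      calc _ = x / (q - c) * (q - c) * c ^ n := by ring
        _ ≤ x * c ^ n := by gcongr; exact Nat.div_mul_le_self _ _
        _ ≤ _ := hx
    rw [hv0] at h
    generalize x / (q - c) = a at h hs ha ⊢
    have hq : 0 < q := by lia
    zify at ha hc hq ⊢
    have hcn : (0 : ℤ) < c ^ n := by positivity
    have h1 : ((a : ℤ) - v n - 1) * q ^ n < 1 * q ^ n := by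
      push_cast at h
      linarith
    have h2 := lt_of_mul_lt_mul_right h1 (by positivity)
    have h3 : ((a : ℤ) - v (n + 1) - 1) * q < 0 * q := by nlinarith
    have h4 := lt_of_mul_lt_mul_right h3 (by positivity)
    linarith
end
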